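/- arXiv:1306.4558 — 3 statements merged into one kernel-verified Lean document; each statement's English description precedes it below -/
import Mathlib

section
/- Let 0 < q < 1 be real, let a be a nonzero complex number, and let k be an integer. Then the theta-product identity holds: (a·q^k ; q)_∞ · (q^{1-k}/a ; q)_∞ = (-a)^{-k} · q^{-k(k-1)/2} · (a ; q)_∞ · (q/a ; q)_∞. -/
/-- The infinite q-Pochhammer symbol `(a; q)_∞ = ∏_{l=0}^∞ (1 - a q^l)`. -/
noncomputable def qPochInf (a q : ℂ) : ℂ := ∏' l : ℕ, (1 - a * q ^ l)

lemma qPochInf_eq_one_sub_mul (x q : ℂ) (hq : ‖q‖ < 1) :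
    qPochInf x q = (1 - x) * qPochInf (x * q) q := by
  have hm : Multipliable fun l : ℕ => 1 - x * q ^ (l + 1) := by
    simp_rw [sub_eq_add_neg]
    apply multipliable_one_add_of_summable
    simp_rw [norm_neg, norm_mul, norm_pow]
    exact ((summable_nat_add_iff 1).2
      (summable_geometric_of_lt_one (norm_nonneg q) hq)).mul_left ‖x‖
  unfold qPochInf
  rw [tprod_eq_zero_mul' (f := fun l : ℕ => 1 - x * q ^ l) hm]
  simp only [pow_zero, mul_one, pow_succ', mul_assoc]

/-- Quasi-periodicity of the theta product `(x; q)_∞ (q/x; q)_∞`. -/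
lemma qPochInf_mul_qPochInf_div (x q : ℂ) (hq0 : q ≠ 0) (hq : ‖q‖ < 1) (hx : x ≠ 0) :
    qPochInf x q * qPochInf (q / x) q =
      -x * (qPochInf (x * q) q * qPochInf (q / (x * q)) q) := by
  have hdiv : q / (x * q) = 1 / x := by field_simp
  rw [hdiv, qPochInf_eq_one_sub_mul x q hq, qPochInf_eq_one_sub_mul (1 / x) q hq,
    one_div_mul_eq_div]
  field_simp
  ring

lemma Int.add_one_mul_div_two (k : ℤ) : (k + 1) * (k + 1 - 1) / 2 = k * (k - 1) / 2 + k := by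
  rw [show (k + 1) * (k + 1 - 1) = k * (k - 1) + k * 2 by ring,
    Int.add_mul_ediv_right _ _ two_ne_zero]

/-- Theta-product identity: for `0 < q < 1`, `a ≠ 0` and `k : ℤ`,
`(a q^k; q)_∞ (q^{1-k}/a; q)_∞ = (-a)^{-k} q^{-k(k-1)/2} (a; q)_∞ (q/a; q)_∞`. -/
theorem theta_product_identity (q : ℝ) (hq0 : 0 < q) (hq1 : q < 1)
    (a : ℂ) (ha : a ≠ 0) (k : ℤ) :
    qPochInf (a * (q : ℂ) ^ k) (q : ℂ) * qPochInf ((q : ℂ) ^ (1 - k) / a) (q : ℂ) =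
      (-a) ^ (-k) * (q : ℂ) ^ (-(k * (k - 1) / 2)) * qPochInf a (q : ℂ) *
        qPochInf ((q : ℂ) / a) (q : ℂ) := by
  have hq : (q : ℂ) ≠ 0 := by exact_mod_cast hq0.ne'
  have hnorm : ‖(q : ℂ)‖ < 1 := by
    rwa [Complex.norm_real, Real.norm_of_nonneg hq0.le]
  have hna : -a ≠ 0 := neg_ne_zero.2 ha
  have hdiv (j : ℤ) : (q : ℂ) ^ (1 - j) / a = q / (a * (q : ℂ) ^ j) := by
    rw [zpow_sub₀ hq, zpow_one, div_div, mul_comm a]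
  have hshift (j : ℤ) :
      qPochInf (a * (q : ℂ) ^ j) q * qPochInf ((q : ℂ) ^ (1 - j) / a) q =
        -(a * (q : ℂ) ^ j) * (qPochInf (a * (q : ℂ) ^ (j + 1)) q *
          qPochInf ((q : ℂ) ^ (1 - (j + 1)) / a) q) := by
    rw [hdiv, hdiv, zpow_add_one₀ hq, ← mul_assoc a]
    exact qPochInf_mul_qPochInf_div _ _ hq hnorm (mul_ne_zero ha (zpow_ne_zero _ hq))
  have hcoeff (j : ℤ) :
      (-a) ^ (-j) * (q : ℂ) ^ (-(j * (j - 1) / 2)) =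
        -(a * (q : ℂ) ^ j) *
          ((-a) ^ (-(j + 1)) * (q : ℂ) ^ (-((j + 1) * (j + 1 - 1) / 2))) := by
    rw [Int.add_one_mul_div_two, show -j = -(j + 1) + 1 by ring, zpow_add_one₀ hna,
      show -(j * (j - 1) / 2) = -(j * (j - 1) / 2 + j) + j by ring, zpow_add₀ hq _ j]
    ring
  have hstep (j : ℤ) : -(a * (q : ℂ) ^ j) ≠ 0 :=
    neg_ne_zero.2 (mul_ne_zero ha (zpow_ne_zero _ hq))
  induction k using Int.induction_on with
  | zero => simp
  | succ n ih =>
    rw [hshift, hcoeff] at ih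
    apply mul_left_cancel₀ (hstep n)
    rw [ih]
    ring
  | pred n ih =>
    rw [hshift, hcoeff, sub_add_cancel, ih]
    ring
end

section
/- Let 0 < q < 1 be real and let k ∈ ℕ with k ≥ 1. For complex λ ≠ 0 such that all denominators below are nonzero and the two series converge, define F(λ) = [(qλ;q²)_∞ (qλ;q²)_∞ (-q^{3-2k}/λ;q²)_∞ (-λq^{2k-1};q²)_∞ / ((q²;q²)_∞ (λ²;q²)_∞ (-q^{2-2k};q²)_∞ (-q^{2k};q²)_∞)] · ₂φ₁(q/λ, q/λ ; q²/λ² ; q², -q^{2k}) + [(q/λ;q²)_∞ (q/λ;q²)_∞ (-λq^{3-2k};q²)_∞ (-q^{2k-1}/λ;q²)_∞ / ((q²;q²)_∞ (1/λ²;q²)_∞ (-q^{2-2k};q²)_∞ (-q^{2k};q²)_∞)] · ₂φ₁(qλ, qλ ; q²λ² ; q², -q^{2k}). Then F(λ) → 1 as λ → q, the limit being taken over λ in the domain of definition of F (which contains a punctured neighbourhood of q). -/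
/-- The finite q-Pochhammer symbol `(a; q)_n = ∏_{l=0}^{n-1} (1 - a q^l)`. -/
noncomputable def qPoch (a q : ℂ) (n : ℕ) : ℂ := ∏ l ∈ Finset.range n, (1 - a * q ^ l)

/-- The basic hypergeometric series `₂φ₁(a, b; c; q, z)`. -/
noncomputable def twoPhiOne (a b c q z : ℂ) : ℂ :=
  ∑' k : ℕ, qPoch a q k * qPoch b q k / (qPoch c q k * qPoch q q k) * z ^ k

open Filter Topology

lemma Filter.Tendsto.fun_div {α 𝕜 : Type*} [NormedField 𝕜] {f g : α → 𝕜} {l : Filter α} {a b : 𝕜}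
    (hf : Tendsto f l (𝓝 a)) (hg : Tendsto g l (𝓝 b)) (hb : b ≠ 0) :
    Tendsto (fun x => f x / g x) l (𝓝 (a / b)) :=
  hf.div hg hb

lemma summable_norm_neg_mul_pow (a : ℂ) {p : ℂ} (hp : ‖p‖ < 1) :
    Summable fun l : ℕ => ‖-(a * p ^ l)‖ := by
  simpa using (summable_geometric_of_lt_one (norm_nonneg p) hp).mul_left ‖a‖

lemma continuous_qPochInf {p : ℂ} (hp : ‖p‖ < 1) : Continuous fun a => qPochInf a p := by
  refine continuous_iff_continuousAt.2 fun a₀ => ?_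
  have hu : Summable fun l : ℕ => (‖a₀‖ + 1) * ‖p‖ ^ l :=
    (summable_geometric_of_lt_one (norm_nonneg p) hp).mul_left _
  have h := hu.hasProdUniformlyOn_nat_one_add (f := fun l a => -(a * p ^ l))
    (isCompact_closedBall a₀ 1)
    (.of_forall fun l a ha => by
      rw [norm_neg, norm_mul, norm_pow]
      have h1 : ‖a - a₀‖ ≤ 1 := by simpa [dist_eq_norm] using ha
      have h2 : ‖a‖ ≤ ‖a₀‖ + 1 := by linarith [norm_le_norm_add_norm_sub' a a₀]
      gcongr) (fun l => by fun_prop)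
  have hc : ContinuousOn (fun a => ∏' l : ℕ, (1 + -(a * p ^ l))) (Metric.closedBall a₀ 1) :=
    h.tendstoUniformlyOn.continuousOn (.of_forall fun s => by fun_prop)
  simpa only [qPochInf, sub_eq_add_neg] using
    hc.continuousAt (Metric.closedBall_mem_nhds a₀ one_pos)

lemma qPochInf_ne_zero {a p : ℂ} (hp : ‖p‖ < 1) (h : ∀ l : ℕ, a * p ^ l ≠ 1) :
    qPochInf a p ≠ 0 := by
  simp only [qPochInf, sub_eq_add_neg]
  refine tprod_one_add_ne_zero_of_summable (fun l hl => h l ?_) (summable_norm_neg_mul_pow a hp)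
  linear_combination -hl

lemma qPochInf_eq_one_sub_mul_s6 (a : ℂ) {p : ℂ} (hp : ‖p‖ < 1) :
    qPochInf a p = (1 - a) * qPochInf (a * p) p := by
  have h : Multipliable fun l : ℕ => 1 - a * p * p ^ l := by
    simpa only [sub_eq_add_neg] using
      multipliable_one_add_of_summable (summable_norm_neg_mul_pow (a * p) hp)
  have h' : Multipliable fun l : ℕ => 1 - a * p ^ (l + 1) :=
    h.congr fun l => by ring
  have h0 : qPochInf a p = (1 - a * p ^ 0) * ∏' l : ℕ, (1 - a * p ^ (l + 1)) :=
    tprod_eq_zero_mul' h'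
  have h1 : ∏' l : ℕ, (1 - a * p ^ (l + 1)) = qPochInf (a * p) p :=
    tprod_congr fun l => by ring
  rw [h0, h1, pow_zero, mul_one]

lemma qPoch_succ (a p : ℂ) (n : ℕ) : qPoch a p (n + 1) = (1 - a) * qPoch (a * p) p n := by
  rw [qPoch, Finset.prod_range_succ', qPoch, mul_comm]
  simp only [pow_zero, mul_one]
  congr 1
  exact Finset.prod_congr rfl fun l _ => by ring

lemma sum_mul_pow_le {x t : ℝ} (hx : 0 ≤ x) (ht0 : 0 ≤ t) (ht1 : t < 1) (n : ℕ) :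
    ∑ l ∈ Finset.range n, x * t ^ l ≤ x / (1 - t) := by
  rw [← Finset.mul_sum, div_eq_mul_inv, ← tsum_geometric_of_lt_one ht0 ht1]
  gcongr
  exact (summable_geometric_of_lt_one ht0 ht1).sum_le_tsum _ fun i _ => by positivity

lemma norm_qPoch_le {a p : ℂ} {R : ℝ} (hp : ‖p‖ < 1) (ha : ‖a‖ ≤ R) (n : ℕ) :
    ‖qPoch a p n‖ ≤ Real.exp (R / (1 - ‖p‖)) := by
  have hR : 0 ≤ R := (norm_nonneg a).trans ha
  calc ‖qPoch a p n‖ = ∏ l ∈ Finset.range n, ‖1 - a * p ^ l‖ := norm_prod _ _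
    _ ≤ ∏ l ∈ Finset.range n, Real.exp (R * ‖p‖ ^ l) := by
      refine Finset.prod_le_prod (fun _ _ => norm_nonneg _) fun l _ => ?_
      have h1 : ‖1 - a * p ^ l‖ ≤ 1 + ‖a‖ * ‖p‖ ^ l := by
        simpa using norm_sub_le (1 : ℂ) (a * p ^ l)
      have h2 : ‖a‖ * ‖p‖ ^ l ≤ R * ‖p‖ ^ l := by gcongr
      linarith [Real.add_one_le_exp (R * ‖p‖ ^ l)]
    _ = Real.exp (∑ l ∈ Finset.range n, R * ‖p‖ ^ l) := (Real.exp_sum _ _).symm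
    _ ≤ _ := Real.exp_le_exp.2 (sum_mul_pow_le hR (norm_nonneg p) hp n)

lemma exp_neg_le_one_sub {x r : ℝ} (hx : 0 ≤ x) (hxr : x ≤ r) (hr : r < 1) :
    Real.exp (-(x / (1 - r))) ≤ 1 - x := by
  have h1 : 0 < 1 - r := by linarith
  have h2 : 0 < 1 - x := by linarith
  rw [Real.exp_neg]
  refine inv_le_of_inv_le₀ h2 ?_
  calc (1 - x)⁻¹ = x / (1 - x) + 1 := by field_simp; ring
    _ ≤ x / (1 - r) + 1 := by gcongr
    _ ≤ _ := Real.add_one_le_exp _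

lemma exp_neg_le_norm_qPoch {c p : ℂ} {r : ℝ} (hp : ‖p‖ < 1) (hr : r < 1) (hc : ‖c‖ ≤ r)
    (n : ℕ) : Real.exp (-(r / (1 - r) / (1 - ‖p‖))) ≤ ‖qPoch c p n‖ := by
  have hr0 : 0 ≤ r := (norm_nonneg c).trans hc
  have hr1 : 0 < 1 - r := by linarith
  calc Real.exp (-(r / (1 - r) / (1 - ‖p‖)))
      ≤ Real.exp (-∑ l ∈ Finset.range n, r / (1 - r) * ‖p‖ ^ l) :=
        Real.exp_le_exp.2 (neg_le_neg (sum_mul_pow_le (by positivity) (norm_nonneg p) hp n))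
    _ = ∏ l ∈ Finset.range n, Real.exp (-(r * ‖p‖ ^ l / (1 - r))) := by
      rw [← Finset.sum_neg_distrib, Real.exp_sum]
      exact Finset.prod_congr rfl fun l _ => by congr 1; ring
    _ ≤ ∏ l ∈ Finset.range n, ‖1 - c * p ^ l‖ := by
      refine Finset.prod_le_prod (fun _ _ => (Real.exp_pos _).le) fun l _ => ?_
      have h1 : r * ‖p‖ ^ l ≤ r := mul_le_of_le_one_right hr0 (pow_le_one₀ (norm_nonneg p) hp.le)
      have h2 := exp_neg_le_one_sub (by positivity) h1 hr
      have h3 : 1 - ‖c‖ * ‖p‖ ^ l ≤ ‖1 - c * p ^ l‖ := by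
        simpa using norm_sub_norm_le (1 : ℂ) (c * p ^ l)
      have h4 : ‖c‖ * ‖p‖ ^ l ≤ r * ‖p‖ ^ l := by gcongr
      linarith
    _ = ‖qPoch c p n‖ := (norm_prod _ _).symm

lemma exists_summable_and_norm_tsum_qPoch_le {p z : ℂ} {R r : ℝ} (hp : ‖p‖ < 1) (hz : ‖z‖ < 1)
    (hr : r < 1) :
    ∃ C, ∀ a b c d : ℂ, ‖a‖ ≤ R → ‖b‖ ≤ R → ‖c‖ ≤ r → ‖d‖ ≤ r →
      Summable (fun n : ℕ => qPoch a p n * qPoch b p n / (qPoch c p n * qPoch d p n) * z ^ n) ∧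
      ‖∑' n : ℕ, qPoch a p n * qPoch b p n / (qPoch c p n * qPoch d p n) * z ^ n‖ ≤ C := by
  set M := Real.exp (R / (1 - ‖p‖))
  set δ := Real.exp (-(r / (1 - r) / (1 - ‖p‖)))
  have hs : Summable fun n : ℕ => M * M / (δ * δ) * ‖z‖ ^ n :=
    (summable_geometric_of_lt_one (norm_nonneg z) hz).mul_left _
  refine ⟨∑' n : ℕ, M * M / (δ * δ) * ‖z‖ ^ n, fun a b c d ha hb hc hd => ?_⟩
  have hle : ∀ n : ℕ, ‖qPoch a p n * qPoch b p n / (qPoch c p n * qPoch d p n) * z ^ n‖ ≤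
      M * M / (δ * δ) * ‖z‖ ^ n := fun n => by
    have h1 := norm_qPoch_le hp ha n
    have h2 := norm_qPoch_le hp hb n
    have h3 := exp_neg_le_norm_qPoch hp hr hc n
    have h4 := exp_neg_le_norm_qPoch hp hr hd n
    have hδ : 0 < δ := Real.exp_pos _
    rw [norm_mul, norm_div, norm_mul, norm_mul, norm_pow]
    gcongr
  exact ⟨hs.of_norm_bounded hle, tsum_of_norm_bounded hs.hasSum hle⟩

lemma twoPhiOne_eq_one_add {a b c p z : ℂ}
    (h : Summable fun n : ℕ => qPoch (a * p) p n * qPoch (b * p) p n /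
      (qPoch (c * p) p n * qPoch (p * p) p n) * z ^ n) :
    twoPhiOne a b c p z = 1 + (1 - a) * (1 - b) / ((1 - c) * (1 - p)) * z *
      ∑' n : ℕ, qPoch (a * p) p n * qPoch (b * p) p n /
        (qPoch (c * p) p n * qPoch (p * p) p n) * z ^ n := by
  have key : ∀ n : ℕ, qPoch a p (n + 1) * qPoch b p (n + 1) /
      (qPoch c p (n + 1) * qPoch p p (n + 1)) * z ^ (n + 1) =
      (1 - a) * (1 - b) / ((1 - c) * (1 - p)) * z * (qPoch (a * p) p n * qPoch (b * p) p n /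
        (qPoch (c * p) p n * qPoch (p * p) p n) * z ^ n) := fun n => by
    simp only [qPoch_succ, div_eq_mul_inv, mul_inv]
    ring
  rw [twoPhiOne, tsum_eq_zero_add' ((h.mul_left _).congr fun n => (key n).symm), tsum_congr key,
    tsum_mul_left]
  simp [qPoch]

lemma neg_zpow_mul_pow_ne_one {q : ℝ} (hq : 0 < q) (m : ℤ) (l : ℕ) :
    -(q : ℂ) ^ m * ((q : ℂ) ^ 2) ^ l ≠ 1 := by
  have h : 0 < q ^ m * (q ^ 2) ^ l := by positivity
  intro h1
  have h2 : -(q ^ m * (q ^ 2) ^ l) = 1 := by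
    apply Complex.ofReal_injective
    push_cast
    linear_combination h1
  linarith

/-- The two-term expression `F(λ)`, obtained by applying the three-term
transformation formula for `₂φ₁` to the spherical matrix coefficient of extended
quantum `SU(1,1)` at the point `p₀ = q^k`, tends to `1` as `λ → q`, the limit
being taken over the domain of definition of `F` (where `λ ≠ 0` and `λ²` is not
an integer power `q^{2i}`, `i ∈ ℤ`), which contains a punctured neighbourhood
of `q`. -/
theorem F_tendsto_one (q : ℝ) (hq0 : 0 < q) (hq1 : q < 1) (k : ℕ) (hk : 1 ≤ k) :
    Filter.Tendsto
      (fun lam : ℂ =>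
        qPochInf ((q : ℂ) * lam) ((q : ℂ) ^ 2) * qPochInf ((q : ℂ) * lam) ((q : ℂ) ^ 2) *
            qPochInf (-(q : ℂ) ^ ((3 : ℤ) - 2 * (k : ℤ)) / lam) ((q : ℂ) ^ 2) *
            qPochInf (-(lam * (q : ℂ) ^ (2 * (k : ℤ) - 1))) ((q : ℂ) ^ 2) /
            (qPochInf ((q : ℂ) ^ 2) ((q : ℂ) ^ 2) * qPochInf (lam ^ 2) ((q : ℂ) ^ 2) *
              qPochInf (-(q : ℂ) ^ ((2 : ℤ) - 2 * (k : ℤ))) ((q : ℂ) ^ 2) *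
              qPochInf (-(q : ℂ) ^ (2 * (k : ℤ))) ((q : ℂ) ^ 2)) *
            twoPhiOne ((q : ℂ) / lam) ((q : ℂ) / lam) ((q : ℂ) ^ 2 / lam ^ 2)
              ((q : ℂ) ^ 2) (-(q : ℂ) ^ (2 * (k : ℤ))) +
          qPochInf ((q : ℂ) / lam) ((q : ℂ) ^ 2) * qPochInf ((q : ℂ) / lam) ((q : ℂ) ^ 2) *
            qPochInf (-(lam * (q : ℂ) ^ ((3 : ℤ) - 2 * (k : ℤ)))) ((q : ℂ) ^ 2) *
            qPochInf (-(q : ℂ) ^ (2 * (k : ℤ) - 1) / lam) ((q : ℂ) ^ 2) /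
            (qPochInf ((q : ℂ) ^ 2) ((q : ℂ) ^ 2) * qPochInf (1 / lam ^ 2) ((q : ℂ) ^ 2) *
              qPochInf (-(q : ℂ) ^ ((2 : ℤ) - 2 * (k : ℤ))) ((q : ℂ) ^ 2) *
              qPochInf (-(q : ℂ) ^ (2 * (k : ℤ))) ((q : ℂ) ^ 2)) *
            twoPhiOne ((q : ℂ) * lam) ((q : ℂ) * lam) ((q : ℂ) ^ 2 * lam ^ 2)
              ((q : ℂ) ^ 2) (-(q : ℂ) ^ (2 * (k : ℤ))))
      (nhdsWithin (q : ℂ)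
        {lam : ℂ | lam ≠ 0 ∧ ∀ i : ℤ, lam ^ 2 ≠ (q : ℂ) ^ (2 * i)})
      (nhds 1) := by
  set p : ℂ := (q : ℂ) ^ 2 with hp_def
  have hqC : (q : ℂ) ≠ 0 := by exact_mod_cast hq0.ne'
  have hpn : ‖p‖ = q ^ 2 := by simp [p, abs_of_pos hq0]
  have hqq : q ^ 2 < q := by nlinarith
  have hp : ‖p‖ < 1 := by rw [hpn]; linarith
  set z : ℂ := -(q : ℂ) ^ (2 * (k : ℤ)) with hz_def
  have hz : ‖z‖ < 1 := by
    have h1 : ‖z‖ = q ^ (2 * k) := by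
      rw [hz_def, norm_neg, norm_zpow, Complex.norm_real, Real.norm_of_nonneg hq0.le]
      exact_mod_cast zpow_natCast q (2 * k)
    rw [h1]
    exact pow_lt_one₀ hq0.le hq1 (by omega)
  obtain ⟨C, hC⟩ := exists_summable_and_norm_tsum_qPoch_le (R := 2) hp hz hq1
  set S : Set ℂ := {lam : ℂ | lam ≠ 0 ∧ ∀ i : ℤ, lam ^ 2 ≠ (q : ℂ) ^ (2 * i)}
  have hid : Tendsto (fun lam : ℂ => lam) (𝓝[S] (q : ℂ)) (𝓝 (q : ℂ)) :=
    tendsto_id.mono_left nhdsWithin_le_nhds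
  have ha : Tendsto (fun lam : ℂ => (q : ℂ) / lam) (𝓝[S] (q : ℂ)) (𝓝 1) := by
    simpa [hqC] using (tendsto_const_nhds (x := (q : ℂ))).fun_div hid hqC
  have hmem : ∀ᶠ lam in 𝓝[S] (q : ℂ), lam ∈ S := self_mem_nhdsWithin
  have hne : ∀ lam ∈ S, (1 - (q : ℂ) / lam) ≠ 0 := fun lam hlam h => by
    have h0 := hlam.1
    refine hlam.2 1 ?_
    rw [← (div_eq_one_iff_eq h0).1 (sub_eq_zero.1 h).symm, mul_one]
    norm_cast
  have hratio : Tendsto (fun lam : ℂ => (1 - (q : ℂ) / lam) / (1 + (q : ℂ) / lam))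
      (𝓝[S] (q : ℂ)) (𝓝 0) := by
    simpa using (ha.const_sub 1).fun_div (ha.const_add 1) (by norm_num)
  have hQ : ∀ {f : ℂ → ℂ} {x : ℂ}, Tendsto f (𝓝[S] (q : ℂ)) (𝓝 x) →
      Tendsto (fun lam => qPochInf (f lam) p) (𝓝[S] (q : ℂ)) (𝓝 (qPochInf x p)) :=
    fun hf => ((continuous_qPochInf hp).tendsto _).comp hf
  have hnorm : ∀ {f : ℂ → ℂ} {x : ℂ} {R : ℝ}, Tendsto f (𝓝[S] (q : ℂ)) (𝓝 x) → ‖x‖ < R →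
      ∀ᶠ lam in 𝓝[S] (q : ℂ), ‖f lam‖ ≤ R :=
    fun hf hx => (hf.norm.eventually_lt_const hx).mono fun _ h => h.le
  have hpp : ∀ l : ℕ, p * p ^ l ≠ 1 := fun l h => by
    have h1 : ‖p * p ^ l‖ < 1 := by
      rw [← pow_succ', norm_pow]
      exact pow_lt_one₀ (norm_nonneg p) hp (by omega)
    rw [h, norm_one] at h1
    exact lt_irrefl _ h1
  have hQp : qPochInf p p ≠ 0 := qPochInf_ne_zero hp hpp
  have hQ1 : qPochInf (-(q : ℂ) ^ ((2 : ℤ) - 2 * (k : ℤ))) p ≠ 0 :=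
    qPochInf_ne_zero hp (neg_zpow_mul_pow_ne_one hq0 _)
  have hQz : qPochInf z p ≠ 0 := qPochInf_ne_zero hp (neg_zpow_mul_pow_ne_one hq0 _)
  have hqlam : Tendsto (fun lam : ℂ => (q : ℂ) * lam) (𝓝[S] (q : ℂ)) (𝓝 p) := by
    simpa [p, sq] using hid.const_mul (q : ℂ)
  have hap : Tendsto (fun lam : ℂ => (q : ℂ) / lam * p) (𝓝[S] (q : ℂ)) (𝓝 p) := by
    simpa using ha.mul_const p
  have ha2 : Tendsto (fun lam : ℂ => p / lam ^ 2) (𝓝[S] (q : ℂ)) (𝓝 1) := by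
    simpa [p, div_pow] using ha.pow 2
  have ha2p : Tendsto (fun lam : ℂ => p / lam ^ 2 * p) (𝓝[S] (q : ℂ)) (𝓝 p) := by
    simpa using ha2.mul_const p
  have hphi1 : Tendsto (fun lam : ℂ => twoPhiOne ((q : ℂ) / lam) ((q : ℂ) / lam) (p / lam ^ 2) p z)
      (𝓝[S] (q : ℂ)) (𝓝 1) := by
    have hbdd : ∀ᶠ lam in 𝓝[S] (q : ℂ), ‖(q : ℂ) / lam * p‖ ≤ 2 ∧ ‖p / lam ^ 2 * p‖ ≤ q :=
      (hnorm hap (by linarith)).and (hnorm ha2p (by rw [hpn]; exact hqq))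
    have hppq : ‖p * p‖ ≤ q := by
      rw [norm_mul, hpn]
      nlinarith
    have hzero : Tendsto (fun lam : ℂ =>
        (1 - (q : ℂ) / lam) / (1 + (q : ℂ) / lam) * (1 / (1 - p) * z) *
        ∑' n : ℕ, qPoch ((q : ℂ) / lam * p) p n * qPoch ((q : ℂ) / lam * p) p n /
        (qPoch (p / lam ^ 2 * p) p n * qPoch (p * p) p n) * z ^ n) (𝓝[S] (q : ℂ)) (𝓝 0) := by
      refine Tendsto.zero_mul_isBoundedUnder_le (by simpa using hratio.mul_const _) ?_
      refine isBoundedUnder_of_eventually_le (a := C) (hbdd.mono fun lam h => ?_)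
      exact (hC _ _ _ _ h.1 h.1 h.2 hppq).2
    have h1 := hzero.const_add 1
    rw [add_zero] at h1
    refine h1.congr' ?_
    filter_upwards [hbdd, hmem] with lam h hlam
    rw [twoPhiOne_eq_one_add (hC _ _ _ _ h.1 h.1 h.2 hppq).1]
    have h2 := hne lam hlam
    have h3 : 1 - p / lam ^ 2 = (1 - (q : ℂ) / lam) * (1 + (q : ℂ) / lam) := by
      simp only [p]; ring
    have h4 : (1 - (q : ℂ) / lam) * (1 - (q : ℂ) / lam) / ((1 - p / lam ^ 2) * (1 - p)) =
        (1 - (q : ℂ) / lam) / (1 + (q : ℂ) / lam) * (1 / (1 - p)) := by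
      rw [h3, mul_assoc, mul_div_mul_left _ _ h2, div_mul_div_comm, mul_one]
    rw [h4, mul_assoc _ _ z]
  have hX : Tendsto (fun lam : ℂ => -(q : ℂ) ^ ((3 : ℤ) - 2 * (k : ℤ)) / lam) (𝓝[S] (q : ℂ))
      (𝓝 (-(q : ℂ) ^ ((2 : ℤ) - 2 * (k : ℤ)))) := by
    have h := (tendsto_const_nhds (x := -(q : ℂ) ^ ((3 : ℤ) - 2 * (k : ℤ)))).fun_div hid hqC
    have e : -(q : ℂ) ^ ((3 : ℤ) - 2 * (k : ℤ)) / q = -(q : ℂ) ^ ((2 : ℤ) - 2 * (k : ℤ)) := by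
      rw [neg_div, div_eq_mul_inv, ← zpow_sub_one₀ hqC]
      ring_nf
    rwa [e] at h
  have hY : Tendsto (fun lam : ℂ => -(lam * (q : ℂ) ^ (2 * (k : ℤ) - 1))) (𝓝[S] (q : ℂ))
      (𝓝 z) := by
    have h := (hid.mul_const ((q : ℂ) ^ (2 * (k : ℤ) - 1))).neg
    have e : -((q : ℂ) * (q : ℂ) ^ (2 * (k : ℤ) - 1)) = z := by
      rw [← zpow_one_add₀ hqC, hz_def]
      ring_nf
    rwa [e] at h
  have hlam2 : Tendsto (fun lam : ℂ => lam ^ 2) (𝓝[S] (q : ℂ)) (𝓝 p) := hid.pow 2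
  have hfst := (((((hQ hqlam).mul (hQ hqlam)).mul (hQ hX)).mul (hQ hY)).fun_div
    (((tendsto_const_nhds (x := qPochInf p p)).mul (hQ hlam2)).mul_const
      (qPochInf (-(q : ℂ) ^ ((2 : ℤ) - 2 * (k : ℤ))) p) |>.mul_const (qPochInf z p))
    (mul_ne_zero (mul_ne_zero (mul_ne_zero hQp hQp) hQ1) hQz)).mul hphi1
  rw [div_self (mul_ne_zero (mul_ne_zero (mul_ne_zero hQp hQp) hQ1) hQz), one_mul] at hfst
  have hlinv : Tendsto (fun lam : ℂ => 1 - 1 / lam ^ 2) (𝓝[S] (q : ℂ)) (𝓝 (1 - 1 / p)) :=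
    (tendsto_const_nhds.fun_div hlam2 (pow_ne_zero 2 hqC)).const_sub 1
  have hlinv0 : 1 - 1 / p ≠ 0 := fun h => by
    have h1 : p = 1 := by
      have : p ≠ 0 := pow_ne_zero 2 hqC
      field_simp at h
      linear_combination h
    rw [h1, norm_one] at hp
    exact lt_irrefl _ hp
  have hU : Tendsto (fun lam : ℂ => -(lam * (q : ℂ) ^ ((3 : ℤ) - 2 * (k : ℤ)))) (𝓝[S] (q : ℂ))
      (𝓝 (-((q : ℂ) * (q : ℂ) ^ ((3 : ℤ) - 2 * (k : ℤ))))) := (hid.mul_const _).neg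
  have hV : Tendsto (fun lam : ℂ => -(q : ℂ) ^ (2 * (k : ℤ) - 1) / lam) (𝓝[S] (q : ℂ))
      (𝓝 (-(q : ℂ) ^ (2 * (k : ℤ) - 1) / q)) := tendsto_const_nhds.fun_div hid hqC
  have hcoef := hratio.mul (((((hQ hap).mul (hQ hap)).mul (hQ hU)).mul (hQ hV)).fun_div
    ((((hlinv.mul (hQ ha2p)).const_mul (qPochInf p p)).mul_const
      (qPochInf (-(q : ℂ) ^ ((2 : ℤ) - 2 * (k : ℤ))) p)).mul_const (qPochInf z p))
    (mul_ne_zero (mul_ne_zero (mul_ne_zero hQp (mul_ne_zero hlinv0 hQp)) hQ1) hQz))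
  rw [zero_mul] at hcoef
  have hc2 : Tendsto (fun lam : ℂ => p * lam ^ 2) (𝓝[S] (q : ℂ)) (𝓝 (p * p)) :=
    hlam2.const_mul p
  have hbdd2 : IsBoundedUnder (· ≤ ·) (𝓝[S] (q : ℂ))
      (norm ∘ fun lam : ℂ => twoPhiOne ((q : ℂ) * lam) ((q : ℂ) * lam) (p * lam ^ 2) p z) := by
    refine isBoundedUnder_of_eventually_le (a := C) ?_
    filter_upwards [hnorm hqlam (show ‖p‖ < 2 by linarith),
      hnorm hc2 (show ‖p * p‖ < q by rw [norm_mul, hpn]; nlinarith)] with lam h1 h2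
    exact (hC _ _ _ _ h1 h1 h2 (by rw [hpn]; exact hqq.le)).2
  have hsnd := hcoef.zero_mul_isBoundedUnder_le hbdd2
  have hsum := hfst.add hsnd
  rw [add_zero] at hsum
  refine hsum.congr' ?_
  filter_upwards [hmem] with lam hlam
  congr 2
  have h2 := hne lam hlam
  have h3 : 1 - 1 / lam ^ 2 * p = (1 - (q : ℂ) / lam) * (1 + (q : ℂ) / lam) := by
    simp only [p]; ring
  rw [qPochInf_eq_one_sub_mul_s6 ((q : ℂ) / lam) hp, qPochInf_eq_one_sub_mul_s6 (1 / lam ^ 2) hp,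
    qPochInf_eq_one_sub_mul_s6 (1 / lam ^ 2 * p) hp, h3,
    show 1 / lam ^ 2 * p * p = p / lam ^ 2 * p by ring, div_mul_div_comm,
    ← mul_div_mul_left _ _ h2]
  congr 1 <;> ring
end

section
/- Let 0 < q < 1 be real, let l ∈ ℤ and m ∈ ℕ. Set c_q = (√2 · q · (q²;q²)_∞ · (-q²;q²)_∞)^{-1}. Then the following identity of positive real numbers holds: q^{2l+2m} · q^{(l-1)(l-2)/2} · q^{(l+2m-1)(l+2m-2)/2} · c_q² · √( (-q^{2l};q²)_∞ · (-q^{2l+4m};q²)_∞ ) · (q²;q²)_∞ · (q²;q²)_∞ · (-q^{2-2l-4m};q²)_∞ = √( (-q^{2-2l-4m};q²)_{2m} ). -/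
/-- The finite real q-Pochhammer symbol `(a; q)_n = ∏_{i=0}^{n-1} (1 - a q^i)`. -/
noncomputable def qPochR (a q : ℝ) (n : ℕ) : ℝ := ∏ i ∈ Finset.range n, (1 - a * q ^ i)

/-- The infinite real q-Pochhammer symbol `(a; q)_∞ = ∏_{i=0}^∞ (1 - a q^i)`. -/
noncomputable def qPochInfR (a q : ℝ) : ℝ := ∏' i : ℕ, (1 - a * q ^ i)

/-- The normalization constant `c_q = (√2 · q · (q²;q²)_∞ · (-q²;q²)_∞)⁻¹` of
extended quantum `SU(1,1)`. -/
noncomputable def cq (q : ℝ) : ℝ :=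
  (Real.sqrt 2 * q * qPochInfR (q ^ 2) (q ^ 2) * qPochInfR (-q ^ 2) (q ^ 2))⁻¹

theorem summable_const_mul_pow {p : ℝ} (hp0 : 0 ≤ p) (hp1 : p < 1) (a : ℝ) :
    Summable fun i : ℕ ↦ -(a * p ^ i) :=
  ((summable_geometric_of_lt_one hp0 hp1).mul_left a).neg

theorem multipliable_one_sub_mul_pow {p : ℝ} (hp0 : 0 ≤ p) (hp1 : p < 1) (a : ℝ) :
    Multipliable fun i : ℕ ↦ 1 - a * p ^ i := by
  simpa only [sub_eq_add_neg] using
    Real.multipliable_one_add_of_summable (summable_const_mul_pow hp0 hp1 a)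

theorem qPochInfR_pos {a p : ℝ} (hp0 : 0 ≤ p) (hp1 : p < 1) (ha : a < 1) :
    0 < qPochInfR a p := by
  have hpos (i : ℕ) : 0 < 1 - a * p ^ i := by
    have h0 : 0 ≤ p ^ i := pow_nonneg hp0 i
    have h1 : p ^ i ≤ 1 := pow_le_one₀ hp0 hp1.le
    rcases le_or_gt a 0 with h | h
    · nlinarith
    · nlinarith
  have hlog : Summable fun i : ℕ ↦ Real.log (1 - a * p ^ i) := by
    simpa only [sub_eq_add_neg] using
      Real.summable_log_one_add_of_summable (summable_const_mul_pow hp0 hp1 a)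
  rw [qPochInfR, ← Real.rexp_tsum_eq_tprod hpos hlog]
  exact Real.exp_pos _

theorem qPochR_mul_qPochInfR {p : ℝ} (hp0 : 0 ≤ p) (hp1 : p < 1) (a : ℝ) (n : ℕ) :
    qPochR a p n * qPochInfR (a * p ^ n) p = qPochInfR a p := by
  have hshift (i : ℕ) : 1 - a * p ^ n * p ^ i = 1 - a * p ^ (i + n) := by ring
  have h := multipliable_one_sub_mul_pow hp0 hp1 (a * p ^ n)
  simp only [hshift] at h
  simp only [qPochR, qPochInfR, hshift]
  exact h.prod_mul_tprod_nat_mul'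

theorem one_sub_mul_qPochInfR {p : ℝ} (hp0 : 0 ≤ p) (hp1 : p < 1) (a : ℝ) :
    (1 - a) * qPochInfR (a * p) p = qPochInfR a p := by
  simpa [qPochR] using qPochR_mul_qPochInfR hp0 hp1 a 1

/-- Quasi-periodicity of the theta function `(-x; q²)_∞ (-q²/x; q²)_∞` at even powers of `q`. -/
theorem qPochInfR_mul_qPochInfR_reflect {q : ℝ} (hq0 : 0 < q) (hq1 : q < 1) (n : ℤ) :
    qPochInfR (-q ^ (2 * n)) (q ^ 2) * qPochInfR (-q ^ (2 - 2 * n)) (q ^ 2) * q ^ (n * (n - 1)) =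
      2 * qPochInfR (-q ^ 2) (q ^ 2) ^ 2 := by
  have hp0 : 0 ≤ q ^ 2 := by positivity
  have hp1 : q ^ 2 < 1 := pow_lt_one₀ hq0.le hq1 two_ne_zero
  have hq : q ≠ 0 := hq0.ne'
  have hrec (k : ℤ) : (1 + q ^ (2 * k)) * qPochInfR (-q ^ (2 * (k + 1))) (q ^ 2) =
      qPochInfR (-q ^ (2 * k)) (q ^ 2) := by
    rw [← one_sub_mul_qPochInfR hp0 hp1 (-q ^ (2 * k)), sub_neg_eq_add, neg_mul,
      ← zpow_natCast q 2, ← zpow_add₀ hq]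
    congr 4
    push_cast
    ring
  have hstep (k : ℤ) :
      qPochInfR (-q ^ (2 * (k + 1))) (q ^ 2) * qPochInfR (-q ^ (2 - 2 * (k + 1))) (q ^ 2) *
          q ^ ((k + 1) * (k + 1 - 1)) =
        qPochInfR (-q ^ (2 * k)) (q ^ 2) * qPochInfR (-q ^ (2 - 2 * k)) (q ^ 2) *
          q ^ (k * (k - 1)) := by
    have h := hrec (-k)
    rw [show 2 * (-k + 1) = 2 - 2 * k by ring] at h
    rw [show 2 - 2 * (k + 1) = 2 * -k by ring, ← h, ← hrec k,
      show (k + 1) * (k + 1 - 1) = k * (k - 1) + 2 * k by ring, zpow_add₀ hq,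
      show 2 * -k = -(2 * k) by ring, zpow_neg]
    have : q ^ (2 * k) ≠ 0 := zpow_ne_zero _ hq
    field_simp
    ring
  induction n using Int.induction_on with
  | zero =>
    have h := hrec 0
    have h2 : qPochInfR (-q ^ (2 * (0 + 1) : ℤ)) (q ^ 2) = qPochInfR (-q ^ 2) (q ^ 2) := by
      norm_cast
    have h3 : qPochInfR (-q ^ (2 - 2 * 0 : ℤ)) (q ^ 2) = qPochInfR (-q ^ 2) (q ^ 2) := by
      norm_cast
    rw [← h, h2, h3, mul_zero, zero_mul, zpow_zero]
    ring
  | succ i ih => rw [hstep, ih]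
  | pred i ih =>
    rw [← hstep, sub_add_cancel, ih]

/-- Closed form of the prefactor of the `₂φ₁`-series in the spherical matrix
coefficient of the principal series corepresentations of extended quantum
`SU(1,1)`, evaluated at `p₁ = q^l`. -/
theorem prefactor_eq_sqrt (q : ℝ) (hq0 : 0 < q) (hq1 : q < 1) (l : ℤ) (m : ℕ) :
    q ^ (2 * l + 2 * (m : ℤ)) * q ^ ((l - 1) * (l - 2) / 2) *
        q ^ ((l + 2 * (m : ℤ) - 1) * (l + 2 * (m : ℤ) - 2) / 2) * cq q ^ 2 *
        Real.sqrt (qPochInfR (-q ^ (2 * l)) (q ^ 2) *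
          qPochInfR (-q ^ (2 * l + 4 * (m : ℤ))) (q ^ 2)) *
        qPochInfR (q ^ 2) (q ^ 2) * qPochInfR (q ^ 2) (q ^ 2) *
        qPochInfR (-q ^ ((2 : ℤ) - 2 * l - 4 * (m : ℤ))) (q ^ 2) =
      Real.sqrt (qPochR (-q ^ ((2 : ℤ) - 2 * l - 4 * (m : ℤ))) (q ^ 2) (2 * m)) := by
  have hp0 : 0 ≤ q ^ 2 := by positivity
  have hp1 : q ^ 2 < 1 := pow_lt_one₀ hq0.le hq1 two_ne_zero
  have hq : q ≠ 0 := hq0.ne'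
  have hpos (k : ℤ) : 0 < qPochInfR (-q ^ k) (q ^ 2) :=
    qPochInfR_pos hp0 hp1 (by linarith [zpow_pos hq0 k])
  have hF : 0 < qPochInfR (-q ^ 2) (q ^ 2) := mod_cast hpos 2
  have hG : 0 < qPochInfR (q ^ 2) (q ^ 2) := qPochInfR_pos hp0 hp1 hp1
  have hS := hpos (2 - 2 * l)
  have hP := hpos (2 * l)
  have hQ := hpos (2 * l + 4 * (m : ℤ))
  have hR := hpos (2 - 2 * l - 4 * (m : ℤ))
  have hPS := qPochInfR_mul_qPochInfR_reflect hq0 hq1 l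
  have hQR := qPochInfR_mul_qPochInfR_reflect hq0 hq1 (l + 2 * m)
  rw [show 2 * (l + 2 * (m : ℤ)) = 2 * l + 4 * m by ring,
    show 2 - (2 * l + 4 * (m : ℤ)) = 2 - 2 * l - 4 * m by ring] at hQR
  have hTS := qPochR_mul_qPochInfR hp0 hp1 (-q ^ (2 - 2 * l - 4 * (m : ℤ))) (2 * m)
  rw [neg_mul, ← pow_mul, ← zpow_natCast q (2 * (2 * m)), ← zpow_add₀ hq,
    show 2 - 2 * l - 4 * (m : ℤ) + ((2 * (2 * m) : ℕ) : ℤ) = 2 - 2 * l by push_cast; ring] at hTS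
  have hhalf (n : ℤ) : 2 * ((n - 1) * (n - 2) / 2) = (n - 1) * (n - 2) := by
    have h := (Int.even_mul_pred_self (n - 1)).two_dvd
    rw [show n - 1 - 1 = n - 2 by ring] at h
    exact Int.mul_ediv_cancel' h
  have hA : (q ^ (2 * l + 2 * (m : ℤ)) * q ^ ((l - 1) * (l - 2) / 2) *
      q ^ ((l + 2 * (m : ℤ) - 1) * (l + 2 * (m : ℤ) - 2) / 2)) ^ 2 =
      q ^ 4 * (q ^ (l * (l - 1)) * q ^ ((l + 2 * (m : ℤ)) * (l + 2 * (m : ℤ) - 1))) := by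
    rw [← zpow_natCast q 4]
    simp only [← zpow_add₀ hq]
    rw [← zpow_natCast, ← zpow_mul]
    congr 1
    push_cast
    linear_combination hhalf l + hhalf (l + 2 * m)
  have hc : cq q ^ 2 * (2 * q ^ 2 * qPochInfR (q ^ 2) (q ^ 2) ^ 2 *
      qPochInfR (-q ^ 2) (q ^ 2) ^ 2) = 1 := by
    rw [cq, inv_pow, mul_pow, mul_pow, mul_pow, Real.sq_sqrt zero_le_two]
    exact inv_mul_cancel₀ (by positivity)
  have hA0 : 0 < q ^ (2 * l + 2 * (m : ℤ)) * q ^ ((l - 1) * (l - 2) / 2) *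
      q ^ ((l + 2 * (m : ℤ) - 1) * (l + 2 * (m : ℤ) - 2) / 2) := by positivity
  have hs := Real.sqrt_nonneg (qPochInfR (-q ^ (2 * l)) (q ^ 2) *
    qPochInfR (-q ^ (2 * l + 4 * (m : ℤ))) (q ^ 2))
  have hsq := Real.sq_sqrt (mul_pos hP hQ).le
  generalize q ^ (2 * l + 2 * (m : ℤ)) * q ^ ((l - 1) * (l - 2) / 2) *
      q ^ ((l + 2 * (m : ℤ) - 1) * (l + 2 * (m : ℤ) - 2) / 2) = A at *
  generalize qPochInfR (-q ^ (2 * l)) (q ^ 2) = P at *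
  generalize qPochInfR (-q ^ (2 * l + 4 * (m : ℤ))) (q ^ 2) = Q at *
  generalize qPochInfR (-q ^ (2 - 2 * l - 4 * (m : ℤ))) (q ^ 2) = R at *
  generalize qPochInfR (-q ^ (2 - 2 * l)) (q ^ 2) = S at *
  generalize qPochInfR (q ^ 2) (q ^ 2) = G at *
  generalize qPochInfR (-q ^ 2) (q ^ 2) = F at *
  generalize qPochR (-q ^ (2 - 2 * l - 4 * (m : ℤ))) (q ^ 2) (2 * m) = T at *
  generalize q ^ (l * (l - 1)) = a at *
  generalize q ^ ((l + 2 * (m : ℤ)) * (l + 2 * (m : ℤ) - 1)) = b at *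
  generalize Real.sqrt (P * Q) = s at *
  have hT : T = (A * cq q ^ 2 * s * G * G * R) ^ 2 := by
    apply mul_right_cancel₀ hS.ne'
    symm
    calc (A * cq q ^ 2 * s * G * G * R) ^ 2 * S
        = A ^ 2 * s ^ 2 * (cq q ^ 2) ^ 2 * G ^ 4 * R ^ 2 * S := by ring
      _ = q ^ 4 * (cq q ^ 2) ^ 2 * G ^ 4 * R * (P * S * a) * (Q * R * b) := by
        rw [hA, hsq]; ring
      _ = (cq q ^ 2 * (2 * q ^ 2 * G ^ 2 * F ^ 2)) ^ 2 * R := by rw [hPS, hQR]; ring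
      _ = T * S := by rw [hc, hTS]; ring
  rw [hT, Real.sqrt_sq (by positivity)]
end
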